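/- Let A_1,…,A_m be real symmetric n×n matrices, let ε ∈ (0,1), let ŷ ∈ ℝ^m and ν̂ ∈ ℝ be such that ∑_{i≤m} ŷ_i A_i − ν̂·I ⪯ 0, and let T ∈ ℝ^{d×m} be a matrix satisfying ‖TᵀT ŷ − ŷ‖_∞ ≤ ε‖ŷ‖₂. Then λ_max( ∑_{i≤m} (TᵀT ŷ)_i A_i − ν̂·I ) ≤ ε‖ŷ‖₂·‖Aᵀ‖. -/

import Mathlib

open MeasureTheory Pointwise

/-- Euclidean (ℓ2) norm of a vector in ℝ^k. -/
noncomputable def norm2 {k : ℕ} (x : Fin k → ℝ) : ℝ := Real.sqrt (∑ i, (x i) ^ 2)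

/-- Supremum (ℓ∞) norm of a vector in ℝ^k. -/
noncomputable def normInf {k : ℕ} (x : Fin k → ℝ) : ℝ := ⨆ i, |x i|

/-- Standard Euclidean inner product on ℝ^k. -/
def dotp {k : ℕ} (x y : Fin k → ℝ) : ℝ := ∑ i, x i * y i

/-- ℓ2 operator (spectral) norm of a matrix. -/
noncomputable def specNorm {p q : ℕ} (M : Matrix (Fin p) (Fin q) ℝ) : ℝ :=
  ⨆ u : {u : Fin q → ℝ // norm2 u ≤ 1}, norm2 (M.mulVec u.1)

/-- ‖Aᵀ‖ := sup { ‖∑ i, y i • A i‖₂ : ‖y‖_∞ ≤ 1 }. -/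
noncomputable def ATnorm {n m : ℕ} (A : Fin m → Matrix (Fin n) (Fin n) ℝ) : ℝ :=
  ⨆ y : {y : Fin m → ℝ // normInf y ≤ 1}, specNorm (∑ i, y.1 i • A i)

/-- Smallest eigenvalue of a real symmetric matrix, via the Rayleigh quotient. -/
noncomputable def lambdaMin {n : ℕ} (M : Matrix (Fin n) (Fin n) ℝ) : ℝ :=
  ⨅ u : {u : Fin n → ℝ // u ≠ 0}, dotp u.1 (M.mulVec u.1) / (∑ i, (u.1 i) ^ 2)

/-- Largest eigenvalue of a real symmetric matrix, via the Rayleigh quotient. -/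
noncomputable def lambdaMax {n : ℕ} (M : Matrix (Fin n) (Fin n) ℝ) : ℝ :=
  ⨆ u : {u : Fin n → ℝ // u ≠ 0}, dotp u.1 (M.mulVec u.1) / (∑ i, (u.1 i) ^ 2)

/-- Loewner order: X ⪯ Y iff Y - X is positive semidefinite. -/
def PSDle {n : ℕ} (X Y : Matrix (Fin n) (Fin n) ℝ) : Prop := (Y - X).PosSemidef

/-- Frobenius norm of a matrix. -/
noncomputable def frobNorm {n : ℕ} (X : Matrix (Fin n) (Fin n) ℝ) : ℝ :=
  Real.sqrt (∑ i, ∑ j, (X i j) ^ 2)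

/-- A random matrix `T : Ω → ℝ^{d×m}` is a random projection with constants `c, C` if
for every `ε ∈ (0,1)` and `x ∈ ℝ^m`, `(1-ε)‖x‖² ≤ ‖Tx‖² ≤ (1+ε)‖x‖²` holds with
probability at least `1 - c·exp(-C ε² d)`. -/
def IsRandomProjection {Ω : Type*} [MeasurableSpace Ω] (μ : Measure Ω) {d m : ℕ}
    (T : Ω → Matrix (Fin d) (Fin m) ℝ) (c C : ℝ) : Prop :=
  ∀ ε ∈ Set.Ioo (0 : ℝ) 1, ∀ x : Fin m → ℝ,
    1 - c * Real.exp (-C * ε ^ 2 * d) ≤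
      (μ {ω | (1 - ε) * (norm2 x) ^ 2 ≤ (norm2 ((T ω).mulVec x)) ^ 2 ∧
              (norm2 ((T ω).mulVec x)) ^ 2 ≤ (1 + ε) * (norm2 x) ^ 2}).toReal

/-- Gaussian width of a set `S ⊆ ℝ^k`. -/
noncomputable def gaussWidth {k : ℕ} (S : Set (Fin k → ℝ)) : ℝ :=
  ∫ g, (⨆ x : S, dotp g x.1) ∂(Measure.pi fun _ : Fin k => ProbabilityTheory.gaussianReal 0 1)

/-- Radius (w.r.t. the Euclidean norm) of a set `S ⊆ ℝ^k`. -/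
noncomputable def rad2 {k : ℕ} (S : Set (Fin k → ℝ)) : ℝ := ⨆ x : S, norm2 x.1

/-- Diameter (w.r.t. the Euclidean norm) of a set `S ⊆ ℝ^k`. -/
noncomputable def diam2 {k : ℕ} (S : Set (Fin k → ℝ)) : ℝ :=
  ⨆ p : ↥(S ×ˢ S), norm2 (p.1.1 - p.1.2)

theorem norm2_nonneg' {k : ℕ} (x : Fin k → ℝ) : 0 ≤ norm2 x := Real.sqrt_nonneg _

theorem norm2_sq' {k : ℕ} (x : Fin k → ℝ) : norm2 x ^ 2 = ∑ i, (x i) ^ 2 :=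
  Real.sq_sqrt (Finset.sum_nonneg fun i _ => sq_nonneg _)

theorem norm2_smul' {k : ℕ} (c : ℝ) (hc : 0 ≤ c) (x : Fin k → ℝ) :
    norm2 (c • x) = c * norm2 x := by
  unfold norm2
  simp only [Pi.smul_apply, smul_eq_mul, mul_pow]
  rw [← Finset.mul_sum, Real.sqrt_mul (sq_nonneg c), Real.sqrt_sq hc]

theorem dotp_le' {k : ℕ} (x y : Fin k → ℝ) : dotp x y ≤ norm2 x * norm2 y := by
  refine le_of_abs_le (abs_le_of_sq_le_sq ?_  (mul_nonneg (norm2_nonneg' x) (norm2_nonneg' y)))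
  rw [mul_pow, norm2_sq', norm2_sq']
  exact Finset.sum_mul_sq_le_sq_mul_sq _ _ _

theorem norm2_mulVec_le' {n : ℕ} (M : Matrix (Fin n) (Fin n) ℝ) (u : Fin n → ℝ) :
    norm2 (M.mulVec u) ≤ frobNorm M * norm2 u := by
  refine le_of_abs_le (abs_le_of_sq_le_sq ?_  (mul_nonneg (Real.sqrt_nonneg _) (norm2_nonneg' u)))
  rw [mul_pow, norm2_sq', norm2_sq', frobNorm, Real.sq_sqrt (by positivity), Finset.sum_mul]
  refine Finset.sum_le_sum fun i _ => ?_
  exact Finset.sum_mul_sq_le_sq_mul_sq Finset.univ (fun j => M i j) u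

theorem norm2_mulVec_le_frob {n : ℕ} (M : Matrix (Fin n) (Fin n) ℝ)
    (u : {u : Fin n → ℝ // norm2 u ≤ 1}) : norm2 (M.mulVec u.1) ≤ frobNorm M :=
  (norm2_mulVec_le' M u.1).trans (mul_le_of_le_one_right (Real.sqrt_nonneg _) u.2)

theorem specNorm_nonneg' {n : ℕ} (M : Matrix (Fin n) (Fin n) ℝ) : 0 ≤ specNorm M :=
  Real.iSup_nonneg fun _ => norm2_nonneg' _

theorem norm2_mulVec_le_spec {n : ℕ} (M : Matrix (Fin n) (Fin n) ℝ) (u : Fin n → ℝ)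
    (hu : u ≠ 0) : norm2 (M.mulVec u) ≤ specNorm M * norm2 u := by
  have hs : 0 < norm2 u := by
    refine Real.sqrt_pos.2 ?_
    obtain ⟨i, hi⟩ := Function.ne_iff.1 hu
    exact Finset.sum_pos' (fun i _ => sq_nonneg _) ⟨i, Finset.mem_univ _, by have : u i ≠ 0 := hi; positivity⟩
  have hv : norm2 ((norm2 u)⁻¹ • u) ≤ 1 := by
    rw [norm2_smul' _ (by positivity), inv_mul_cancel₀ hs.ne']
  have h : norm2 (M.mulVec ((norm2 u)⁻¹ • u)) ≤ specNorm M :=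
    le_ciSup (f := fun u : {u : Fin n → ℝ // norm2 u ≤ 1} => norm2 (M.mulVec u.1))
      ⟨frobNorm M, by rintro _ ⟨u, rfl⟩; exact norm2_mulVec_le_frob M u⟩ ⟨_, hv⟩
  rw [Matrix.mulVec_smul, norm2_smul' _ (by positivity), inv_mul_le_iff₀ hs] at h
  linarith

theorem abs_le_normInf {k : ℕ} (x : Fin k → ℝ) (i : Fin k) : |x i| ≤ normInf x :=
  le_ciSup (f := fun i => |x i|) (Set.finite_range _).bddAbove i

theorem specNorm_le_ATnorm {n m : ℕ} (A : Fin m → Matrix (Fin n) (Fin n) ℝ)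
    (y : Fin m → ℝ) (hy : normInf y ≤ 1) : specNorm (∑ i, y i • A i) ≤ ATnorm A := by
  refine le_ciSup (f := fun y : {y : Fin m → ℝ // normInf y ≤ 1} => specNorm (∑ i, y.1 i • A i))
    ⟨Real.sqrt (∑ j, ∑ k, (∑ i, |A i j k|) ^ 2), ?_⟩ ⟨y, hy⟩
  rintro _ ⟨y, rfl⟩
  refine Real.iSup_le (fun u => (norm2_mulVec_le_frob _ u).trans ?_) (Real.sqrt_nonneg _)
  refine Real.sqrt_le_sqrt (Finset.sum_le_sum fun j _ => Finset.sum_le_sum fun k _ => ?_)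
  rw [← sq_abs]
  refine pow_le_pow_left₀ (abs_nonneg _) ?_ 2
  simp only [Matrix.sum_apply, Matrix.smul_apply, smul_eq_mul]
  refine (Finset.abs_sum_le_sum_abs _ _).trans (Finset.sum_le_sum fun i _ => ?_)
  rw [abs_mul]
  exact mul_le_of_le_one_left (abs_nonneg _) ((abs_le_normInf y.1 i).trans y.2)

/-- If ∑ ŷᵢAᵢ − ν̂ I ⪯ 0 and ‖TᵀTŷ − ŷ‖_∞ ≤ ε‖ŷ‖₂, then
λ_max(∑ (TᵀTŷ)ᵢ Aᵢ − ν̂ I) ≤ ε‖ŷ‖₂‖Aᵀ‖. -/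
theorem stmt_2 {n m d : ℕ} (A : Fin m → Matrix (Fin n) (Fin n) ℝ)
    (hA : ∀ i, (A i).IsSymm) (ε : ℝ) (hε : ε ∈ Set.Ioo (0 : ℝ) 1)
    (yh : Fin m → ℝ) (νh : ℝ)
    (hfeas : PSDle (∑ i, yh i • A i - νh • (1 : Matrix (Fin n) (Fin n) ℝ)) 0)
    (T : Matrix (Fin d) (Fin m) ℝ)
    (hT : normInf (T.transpose.mulVec (T.mulVec yh) - yh) ≤ ε * norm2 yh) :
    lambdaMax (∑ i, (T.transpose.mulVec (T.mulVec yh)) i • A i -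
        νh • (1 : Matrix (Fin n) (Fin n) ℝ)) ≤ ε * norm2 yh * ATnorm A := by
  have hr : 0 ≤ ε * norm2 yh := mul_nonneg hε.1.le (norm2_nonneg' _)
  have hAT : 0 ≤ ATnorm A := Real.iSup_nonneg fun _ => specNorm_nonneg' _
  set x := T.transpose.mulVec (T.mulVec yh) with hx
  set r := ε * norm2 yh with hrd
  refine Real.iSup_le (fun u => ?_) (mul_nonneg hr hAT)
  obtain ⟨u, hu⟩ := u
  have hz : ∀ i, |x i - yh i| ≤ r := fun i => (abs_le_normInf (x - yh) i).trans hT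
  let w : Fin m → ℝ := fun i => (x i - yh i) / r
  have hw : normInf w ≤ 1 := by
    refine Real.iSup_le (fun i => ?_) zero_le_one
    simp only [w]
    rw [abs_div, abs_of_nonneg hr]
    exact div_le_one_of_le₀ (hz i) hr
  have hwx : ∀ i, x i = yh i + r * w i := by
    intro i
    rcases hr.eq_or_lt with h0 | h0
    · have := hz i
      rw [← h0] at this
      have := abs_nonpos_iff.1 this
      rw [← h0]; linarith
    · simp only [w]; field_simp; ring
  have hM : ∑ i, x i • A i - νh • (1 : Matrix (Fin n) (Fin n) ℝ) =
      (∑ i, yh i • A i - νh • (1 : Matrix (Fin n) (Fin n) ℝ)) + r • ∑ i, w i • A i := by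
    simp only [hwx, add_smul, Finset.sum_add_distrib, Finset.smul_sum, smul_smul]
    abel
  have h1 : dotp u ((∑ i, yh i • A i - νh • (1 : Matrix (Fin n) (Fin n) ℝ)).mulVec u) ≤ 0 := by
    have := hfeas.dotProduct_mulVec_nonneg u
    rw [zero_sub, Matrix.neg_mulVec, dotProduct_neg] at this
    simp only [star_trivial] at this
    change u ⬝ᵥ _ ≤ 0
    linarith
  have h2 : dotp u ((∑ i, w i • A i).mulVec u) ≤ ATnorm A * norm2 u ^ 2 := by
    have a := dotp_le' u ((∑ i, w i • A i).mulVec u)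
    have b := norm2_mulVec_le_spec (∑ i, w i • A i) u hu
    have c := specNorm_le_ATnorm A w hw
    have e := norm2_nonneg' u
    calc _ ≤ _ := a
      _ ≤ norm2 u * (ATnorm A * norm2 u) := by gcongr; exact b.trans (by gcongr)
      _ = _ := by ring
  refine div_le_of_le_mul₀ (Finset.sum_nonneg fun i _ => sq_nonneg _) (mul_nonneg hr hAT) ?_
  change dotp u (Matrix.mulVec _ u) ≤ _ * ∑ i, (u i) ^ 2
  rw [← norm2_sq', hM, Matrix.add_mulVec, Matrix.smul_mulVec]
  have h3 : ∀ p q : Fin n → ℝ, dotp u (p + r • q) = dotp u p + r * dotp u q := by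
    intro p q
    change u ⬝ᵥ _ = u ⬝ᵥ _ + r * (u ⬝ᵥ _)
    rw [dotProduct_add, dotProduct_smul, smul_eq_mul]
  rw [h3]
  have := mul_le_mul_of_nonneg_left h2 hr
  linarith
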